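/- Let $0<\mu<1$, $c>1$, and $A>0$ be fixed. Set $Q_{0}=(\log X)^{A+2}$. Then for all sufficiently large $X$, all real $t$, and all $Q$ with $X(\log X)^{-A}\le Q\le X$, one has $\sum_{Q_{0}<q\le Q}\frac{1}{\varphi(q)}\Big(\log\frac{Q}{q}\Big)\sum^{*}_{\chi\ (\mathrm{mod}\ q)}\Big|\sum_{\mu X<n\le X}\Lambda(n)\chi(n)e(tn^{c})\Big|^{2}\ll XQ\log X$, with the implied constant depending only on $\mu,c,A$. -/

import Mathlib

open Finset
open scoped Classical
noncomputable def e (x : ℝ) : ℂ := Complex.exp (2 * Real.pi * Complex.I * x)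

theorem e_add (x y : ℝ) : e (x + y) = e x * e y := by
  simp only [e, ← Complex.exp_add]
  congr 1; push_cast; ring

theorem norm_e (x : ℝ) : ‖e x‖ = 1 := by
  have : (2 * Real.pi * Complex.I * x : ℂ) = ((2 * Real.pi * x : ℝ) : ℂ) * Complex.I := by
    push_cast; ring
  rw [e, this, Complex.norm_exp_ofReal_mul_I]

theorem conj_e (x : ℝ) : (starRingEnd ℂ) (e x) = e (-x) := by
  rw [e, e, ← Complex.exp_conj]
  congr 1
  simp only [map_mul, Complex.conj_I, Complex.conj_ofReal, Complex.ofReal_neg, Complex.conj_ofNat]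
  ring

theorem e_natCast_mul (n : ℕ) (x : ℝ) : e (n * x) = e x ^ n := by
  rw [e, e, ← Complex.exp_nat_mul]
  congr 1; push_cast; ring

theorem norm_e_sub_one (x : ℝ) : ‖e x - 1‖ = 2 * |Real.sin (Real.pi * x)| := by
  have : (2 * Real.pi * Complex.I * x : ℂ) = Complex.I * ((2 * Real.pi * x : ℝ) : ℂ) := by
    push_cast; ring
  rw [e, this, Complex.norm_exp_I_mul_ofReal_sub_one, Real.norm_eq_abs, abs_mul, abs_two]
  congr 3; ring

theorem two_mul_min_le_sin {t : ℝ} (h0 : 0 ≤ t) (h1 : t ≤ 1) :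
    2 * min t (1 - t) ≤ Real.sin (Real.pi * t) := by
  have hpi := Real.pi_pos
  rcases le_total t (1 - t) with h | h
  · rw [min_eq_left h]
    have := Real.mul_le_sin (x := Real.pi * t) (by positivity) (by nlinarith)
    field_simp at this
    linarith
  · rw [min_eq_right h]
    have := Real.mul_le_sin (x := Real.pi * (1 - t)) (by nlinarith) (by nlinarith)
    rw [mul_sub, mul_one, Real.sin_pi_sub] at this
    field_simp at this
    linarith

/-- The geometric sum bound for exponentials, in terms of the distance to the nearest integer. -/
theorem norm_sum_e_sq_le (M : ℕ) {θ : ℝ} (hθ : 0 < Int.fract θ) :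
    ‖∑ n ∈ range M, e (n * θ)‖ ^ 2 ≤
      (1 / Int.fract θ ^ 2 + 1 / (1 - Int.fract θ) ^ 2) / 4 := by
  set t := Int.fract θ with ht
  have ht1 : 0 < 1 - t := sub_pos.2 (Int.fract_lt_one θ)
  have hsin : |Real.sin (Real.pi * θ)| = |Real.sin (Real.pi * t)| := by
    have : Real.pi * θ = Real.pi * t + ⌊θ⌋ * Real.pi := by
      rw [ht, ← Int.self_sub_floor]; ring
    rw [this, Real.sin_add_int_mul_pi, abs_mul]
    simp
  have hlow : 4 * min t (1 - t) ≤ ‖e θ - 1‖ := by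
    rw [norm_e_sub_one, hsin]
    have := two_mul_min_le_sin hθ.le (by linarith : t ≤ 1)
    have := le_abs_self (Real.sin (Real.pi * t))
    linarith
  have hmin : 0 < min t (1 - t) := lt_min hθ ht1
  have hne : e θ ≠ 1 := by
    intro h
    rw [h, sub_self, norm_zero] at hlow
    linarith
  have hnum : ‖e θ ^ M - 1‖ ≤ 2 := by
    refine (norm_sub_le _ _).trans ?_
    rw [norm_pow, norm_e, one_pow, norm_one]; norm_num
  have hD : ‖∑ n ∈ range M, e (n * θ)‖ ≤ 1 / (2 * min t (1 - t)) := by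
    simp_rw [e_natCast_mul]
    rw [geom_sum_eq hne, norm_div]
    calc _ ≤ 2 / (4 * min t (1 - t)) := by gcongr
      _ = _ := by field_simp; norm_num
  calc _ ≤ (1 / (2 * min t (1 - t))) ^ 2 := by gcongr
    _ = (1 / min t (1 - t) ^ 2) / 4 := by field_simp; norm_num
    _ ≤ _ := by
      gcongr
      rcases le_total t (1 - t) with h | h
      · rw [min_eq_left h]
        have : 0 ≤ 1 / (1 - t) ^ 2 := by positivity
        linarith
      · rw [min_eq_right h]
        have : 0 ≤ 1 / t ^ 2 := by positivity
        linarith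

theorem sum_one_div_sq_le_of_spaced {ι : Type*} (s : Finset ι) (y : ι → ℝ) {δ : ℝ} (hδ : 0 < δ)
    (hy : ∀ i ∈ s, δ ≤ y i) (hs : ∀ i ∈ s, ∀ j ∈ s, i ≠ j → δ ≤ |y i - y j|) :
    ∑ i ∈ s, 1 / y i ^ 2 ≤ 2 / δ ^ 2 := by
  set k : ι → ℕ := fun i ↦ ⌊y i / δ⌋₊
  have hk1 : ∀ i ∈ s, 1 ≤ k i := fun i hi ↦
    Nat.le_floor (by rw [Nat.cast_one, le_div_iff₀ hδ, one_mul]; exact hy i hi)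
  have hle : ∀ i ∈ s, (k i : ℝ) * δ ≤ y i := fun i hi ↦ by
    rw [← le_div_iff₀ hδ]
    exact Nat.floor_le (div_nonneg (hδ.le.trans (hy i hi)) hδ.le)
  have hlt : ∀ i ∈ s, y i < (k i + 1) * δ := fun i _ ↦ by
    rw [← div_lt_iff₀ hδ]
    exact Nat.lt_floor_add_one _
  have hinj : Set.InjOn k s := by
    intro i hi j hj hij
    by_contra hne
    have h := hs i hi j hj hne
    have h1 := hle i hi
    have h2 := hle j hj
    have h3 := hlt i hi
    have h4 := hlt j hj
    rw [hij] at h1 h3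
    exact absurd h (not_le.2 (abs_lt.2 ⟨by linarith, by linarith⟩))
  obtain ⟨M, hM⟩ : ∃ M, ∀ i ∈ s, k i < M :=
    ⟨s.sup k + 1, fun i hi ↦ Nat.lt_succ_of_le (le_sup hi)⟩
  calc ∑ i ∈ s, 1 / y i ^ 2 ≤ ∑ i ∈ s, (1 / δ ^ 2) * ((k i : ℝ) ^ 2)⁻¹ := by
        refine sum_le_sum fun i hi ↦ ?_
        have h1 : (0 : ℝ) < k i := by exact_mod_cast hk1 i hi
        calc 1 / y i ^ 2 ≤ 1 / ((k i : ℝ) * δ) ^ 2 := by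
              gcongr
              exact hle i hi
          _ = _ := by field_simp
    _ = (1 / δ ^ 2) * ∑ m ∈ s.image k, ((m : ℝ) ^ 2)⁻¹ := by
        rw [← mul_sum, sum_image hinj]
    _ ≤ (1 / δ ^ 2) * ∑ m ∈ Ioo 0 M, ((m : ℝ) ^ 2)⁻¹ := by
        gcongr
        intro m hm
        obtain ⟨i, hi, rfl⟩ := mem_image.1 hm
        exact mem_Ioo.2 ⟨hk1 i hi, hM i hi⟩
    _ ≤ (1 / δ ^ 2) * 2 := by
        gcongr
        simpa using sum_Ioo_inv_sq_le (α := ℝ) 0 M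
    _ = _ := by ring

theorem sum_norm_geom_sq_le {ι : Type*} (s : Finset ι) (x : ι → ℝ) {δ : ℝ} (hδ : 0 < δ)
    (hx : ∀ i ∈ s, ∀ j ∈ s, i ≠ j → ∀ m : ℤ, δ ≤ |x i - x j - m|) (M : ℕ) {i : ι} (hi : i ∈ s) :
    ∑ j ∈ s, ‖∑ n ∈ range M, e (n * (x i - x j))‖ ^ 2 ≤ M ^ 2 + 1 / δ ^ 2 := by
  rw [← add_sum_erase s _ hi]
  have hself : ‖∑ n ∈ range M, e (n * (x i - x i))‖ ^ 2 = (M : ℝ) ^ 2 := by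
    simp [e]
  have hlow : ∀ j ∈ s.erase i, δ ≤ Int.fract (x i - x j) := fun j hj ↦ by
    have := hx i hi j (mem_of_mem_erase hj) (ne_of_mem_erase hj).symm ⌊x i - x j⌋
    rwa [Int.self_sub_floor, abs_of_nonneg (Int.fract_nonneg _)] at this
  have hup : ∀ j ∈ s.erase i, δ ≤ 1 - Int.fract (x i - x j) := fun j hj ↦ by
    have := hx i hi j (mem_of_mem_erase hj) (ne_of_mem_erase hj).symm (⌊x i - x j⌋ + 1)
    rw [Int.cast_add, ← sub_sub, Int.self_sub_floor, Int.cast_one, abs_sub_comm,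
      abs_of_nonneg (sub_nonneg.2 (Int.fract_lt_one _).le)] at this
    exact this
  have hsp : ∀ j ∈ s.erase i, ∀ k ∈ s.erase i, j ≠ k →
      δ ≤ |Int.fract (x i - x j) - Int.fract (x i - x k)| := fun j hj k hk hjk ↦ by
    have := hx k (mem_of_mem_erase hk) j (mem_of_mem_erase hj) hjk.symm
      (⌊x i - x j⌋ - ⌊x i - x k⌋)
    rw [← Int.self_sub_floor, ← Int.self_sub_floor]
    push_cast at this
    convert this using 2
    ring
  rw [hself]
  gcongr
  calc _ ≤ ∑ j ∈ s.erase i,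
        (1 / Int.fract (x i - x j) ^ 2 + 1 / (1 - Int.fract (x i - x j)) ^ 2) / 4 :=
        sum_le_sum fun j hj ↦ norm_sum_e_sq_le M (hδ.trans_le (hlow j hj))
    _ = (∑ j ∈ s.erase i, 1 / Int.fract (x i - x j) ^ 2 +
          ∑ j ∈ s.erase i, 1 / (1 - Int.fract (x i - x j)) ^ 2) / 4 := by
        rw [← sum_div, sum_add_distrib]
    _ ≤ (2 / δ ^ 2 + 2 / δ ^ 2) / 4 := by
        gcongr
        · exact sum_one_div_sq_le_of_spaced _ _ hδ hlow hsp
        · refine sum_one_div_sq_le_of_spaced _ _ hδ hup fun j hj k hk hjk ↦ ?_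
          rw [sub_sub_sub_cancel_left, abs_sub_comm]
          exact hsp j hj k hk hjk
    _ = _ := by ring

theorem sum_comm_four {α β γ κ M : Type*} [AddCommMonoid M] (s : Finset α) (t : Finset β)
    (u : Finset γ) (v : Finset κ) (f : α → β → γ → κ → M) :
    ∑ a ∈ s, ∑ b ∈ t, ∑ c ∈ u, ∑ d ∈ v, f a b c d =
      ∑ c ∈ u, ∑ d ∈ v, ∑ a ∈ s, ∑ b ∈ t, f a b c d := by
  rw [← sum_product' s t fun a b ↦ ∑ c ∈ u, ∑ d ∈ v, f a b c d,
    ← sum_product' u v fun c d ↦ ∑ a ∈ s, ∑ b ∈ t, f a b c d]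
  simp only [← sum_product' s t, ← sum_product' u v]
  exact sum_comm

/-- The dual large sieve inequality. -/
theorem dual_large_sieve {ι : Type*} (s : Finset ι) (x : ι → ℝ) {δ : ℝ} (hδ : 0 < δ)
    (hx : ∀ i ∈ s, ∀ j ∈ s, i ≠ j → ∀ m : ℤ, δ ≤ |x i - x j - m|) (b : ι → ℂ) (N : ℕ) :
    N * ∑ n ∈ range N, ‖∑ i ∈ s, b i * e (n * x i)‖ ^ 2 ≤
      (4 * N ^ 2 + 1 / δ ^ 2) * ∑ i ∈ s, ‖b i‖ ^ 2 := by
  set B : ℝ → ℂ := fun t ↦ ∑ i ∈ s, b i * e (t * x i) with hB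
  set D : ℝ → ℂ := fun θ ↦ ∑ n ∈ range (2 * N), e (n * θ) with hD
  have hlower : (N : ℝ) * ∑ n ∈ range N, ‖B n‖ ^ 2 ≤
      ∑ u ∈ range (2 * N), ∑ v ∈ range (2 * N), ‖B (u - v)‖ ^ 2 := by
    have h1 : (N : ℝ) * ∑ n ∈ range N, ‖B n‖ ^ 2 =
        ∑ p ∈ range N ×ˢ range N, ‖B p.1‖ ^ 2 := by
      rw [sum_product_right]; simp
    rw [h1, ← sum_product' (range (2 * N)) (range (2 * N)) fun u v ↦ ‖B ((u : ℝ) - v)‖ ^ 2]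
    set g : ℕ × ℕ → ℕ × ℕ := fun p ↦ (p.1 + p.2, p.2)
    have hg : Function.Injective g := fun p p' h ↦ by
      simp only [g, Prod.mk.injEq] at h
      exact Prod.ext (by omega) h.2
    calc _ = ∑ p ∈ (range N ×ˢ range N).image g, ‖B ((p.1 : ℝ) - p.2)‖ ^ 2 := by
          rw [sum_image hg.injOn]
          refine sum_congr rfl fun p _ ↦ ?_
          simp [g]
      _ ≤ _ := by
          refine sum_le_sum_of_subset_of_nonneg (fun p hp ↦ ?_) fun _ _ _ ↦ by positivity
          obtain ⟨p', hp', rfl⟩ := mem_image.1 hp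
          rw [mem_product, mem_range, mem_range] at hp' ⊢
          exact ⟨by simp only [g]; omega, by simp only [g]; omega⟩
  have hexpand : ((∑ u ∈ range (2 * N), ∑ v ∈ range (2 * N), ‖B (u - v)‖ ^ 2 : ℝ) : ℂ) =
      ∑ i ∈ s, ∑ j ∈ s, b i * (starRingEnd ℂ) (b j) * ((‖D (x i - x j)‖ ^ 2 : ℝ) : ℂ) := by
    have hBsq : ∀ t : ℝ, ((‖B t‖ ^ 2 : ℝ) : ℂ) =
        ∑ i ∈ s, ∑ j ∈ s, b i * (starRingEnd ℂ) (b j) * e (t * (x i - x j)) := by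
      intro t
      rw [Complex.ofReal_pow, ← Complex.mul_conj', hB, map_sum, sum_mul_sum]
      refine sum_congr rfl fun i _ ↦ sum_congr rfl fun j _ ↦ ?_
      rw [map_mul, conj_e, mul_sub, sub_eq_add_neg, e_add]
      ring
    have hDsq : ∀ θ : ℝ, ((‖D θ‖ ^ 2 : ℝ) : ℂ) =
        ∑ u ∈ range (2 * N), ∑ v ∈ range (2 * N), e ((u - v) * θ) := by
      intro θ
      rw [Complex.ofReal_pow, ← Complex.mul_conj', hD, map_sum, sum_mul_sum]
      refine sum_congr rfl fun i _ ↦ sum_congr rfl fun j _ ↦ ?_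
      rw [conj_e, sub_mul, sub_eq_add_neg, e_add]
    simp only [Complex.ofReal_sum, hBsq, hDsq, mul_sum]
    exact sum_comm_four _ _ _ _ _
  have hsym : ∀ i j, ‖D (x i - x j)‖ = ‖D (x j - x i)‖ := by
    intro i j
    rw [← Complex.norm_conj, hD, map_sum]
    congr 1
    refine sum_congr rfl fun n _ ↦ ?_
    rw [conj_e]; congr 1; ring
  refine hlower.trans ?_
  have hrow : ∀ i ∈ s, ∑ j ∈ s, ‖D (x i - x j)‖ ^ 2 ≤ 4 * (N : ℝ) ^ 2 + 1 / δ ^ 2 := by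
    intro i hi
    have := sum_norm_geom_sq_le s x hδ hx (2 * N) hi
    push_cast at this
    rwa [mul_pow, show (2 : ℝ) ^ 2 = 4 by norm_num] at this
  calc _ = ‖((∑ u ∈ range (2 * N), ∑ v ∈ range (2 * N), ‖B (u - v)‖ ^ 2 : ℝ) : ℂ)‖ := by
        rw [Complex.norm_real, Real.norm_of_nonneg (by positivity)]
    _ ≤ ∑ i ∈ s, ∑ j ∈ s, (‖b i‖ ^ 2 * ‖D (x i - x j)‖ ^ 2 / 2 +
          ‖b j‖ ^ 2 * ‖D (x j - x i)‖ ^ 2 / 2) := by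
        rw [hexpand]
        refine (norm_sum_le _ _).trans (sum_le_sum fun i _ ↦ (norm_sum_le _ _).trans
          (sum_le_sum fun j _ ↦ ?_))
        rw [norm_mul, norm_mul, RCLike.norm_conj, Complex.norm_real,
          Real.norm_of_nonneg (by positivity), hsym j i]
        nlinarith [mul_nonneg (sq_nonneg (‖b i‖ - ‖b j‖)) (sq_nonneg ‖D (x i - x j)‖)]
    _ = ∑ i ∈ s, ‖b i‖ ^ 2 * ∑ j ∈ s, ‖D (x i - x j)‖ ^ 2 := by
        simp_rw [sum_add_distrib]
        rw [sum_comm (f := fun i j ↦ ‖b j‖ ^ 2 * ‖D (x j - x i)‖ ^ 2 / 2), ← sum_add_distrib]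
        refine sum_congr rfl fun i _ ↦ ?_
        rw [← sum_add_distrib, mul_sum]
        exact sum_congr rfl fun j _ ↦ by ring
    _ ≤ ∑ i ∈ s, ‖b i‖ ^ 2 * (4 * (N : ℝ) ^ 2 + 1 / δ ^ 2) := by
        gcongr with i hi
        exact hrow i hi
    _ = _ := by rw [← sum_mul, mul_comm]

/-- The large sieve inequality for well-spaced points. -/
theorem large_sieve {ι : Type*} (s : Finset ι) (x : ι → ℝ) {δ : ℝ} (hδ : 0 < δ)
    (hx : ∀ i ∈ s, ∀ j ∈ s, i ≠ j → ∀ m : ℤ, δ ≤ |x i - x j - m|) (a : ℕ → ℂ) {N : ℕ}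
    (hN : 1 / δ ≤ N) :
    ∑ i ∈ s, ‖∑ n ∈ range N, a n * e (n * x i)‖ ^ 2 ≤ 5 * N * ∑ n ∈ range N, ‖a n‖ ^ 2 := by
  set S : ι → ℂ := fun i ↦ ∑ n ∈ range N, a n * e (n * x i) with hS
  set T := ∑ i ∈ s, ‖S i‖ ^ 2 with hT
  set b : ι → ℂ := fun i ↦ (starRingEnd ℂ) (S i)
  have hNpos : (0 : ℝ) < N := (by positivity : 0 < 1 / δ).trans_le hN
  have hdual : ∑ n ∈ range N, ‖∑ i ∈ s, b i * e (n * x i)‖ ^ 2 ≤ 5 * N * T := by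
    have h := dual_large_sieve s x hδ hx b N
    have hb : ∑ i ∈ s, ‖b i‖ ^ 2 = T := by simp [b, hT]
    rw [hb] at h
    have hδN : 1 / δ ^ 2 ≤ (N : ℝ) ^ 2 := by
      rw [← one_div_pow]; gcongr
    have hT0 : 0 ≤ T := by positivity
    refine le_of_mul_le_mul_left (h.trans ?_) hNpos
    nlinarith [mul_le_mul_of_nonneg_right hδN hT0]
  have hTle : T ≤ ∑ n ∈ range N, ‖a n‖ * ‖∑ i ∈ s, b i * e (n * x i)‖ := by
    have h1 : (T : ℂ) = ∑ n ∈ range N, a n * ∑ i ∈ s, b i * e (n * x i) := by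
      rw [hT, Complex.ofReal_sum]
      simp_rw [mul_sum]
      rw [sum_comm]
      refine sum_congr rfl fun i _ ↦ ?_
      rw [Complex.ofReal_pow, ← Complex.conj_mul']
      simp only [hS, mul_sum, b]
      exact sum_congr rfl fun n _ ↦ by ring
    have hT0 : 0 ≤ T := by positivity
    calc T = ‖(T : ℂ)‖ := by rw [Complex.norm_real, Real.norm_of_nonneg hT0]
      _ ≤ _ := by
        rw [h1]
        exact (norm_sum_le _ _).trans_eq (sum_congr rfl fun n _ ↦ norm_mul _ _)
  have hT0 : 0 ≤ T := by positivity
  have hsq : T ^ 2 ≤ (∑ n ∈ range N, ‖a n‖ ^ 2) * (5 * N * T) :=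
    calc T ^ 2 ≤ (∑ n ∈ range N, ‖a n‖ * ‖∑ i ∈ s, b i * e (n * x i)‖) ^ 2 := by gcongr
      _ ≤ _ := sum_mul_sq_le_sq_mul_sq _ _ _
      _ ≤ _ := by gcongr
  rcases hT0.eq_or_lt with h | h
  · rw [← h]; positivity
  · refine le_of_mul_le_mul_right ?_ h
    nlinarith

theorem farey_spacing {R q q' a a' : ℕ} (hq : 0 < q) (hqR : q ≤ R) (hq' : 0 < q') (hqR' : q' ≤ R)
    (ha : a < q) (ha' : a' < q') (hc : a.Coprime q) (hc' : a'.Coprime q')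
    (hne : (q, a) ≠ (q', a')) (m : ℤ) :
    1 / (R : ℝ) ^ 2 ≤ |(a : ℝ) / q - (a' : ℝ) / q' - m| := by
  have hqr : (0 : ℝ) < q := by exact_mod_cast hq
  have hqr' : (0 : ℝ) < q' := by exact_mod_cast hq'
  set k : ℤ := a * q' - a' * q - m * q * q' with hk
  have hk0 : k ≠ 0 := by
    intro h0
    have h1 : (a : ℤ) * q' = q * (a' + m * q') := by linarith
    have h2 : (a' : ℤ) * q = q' * (a - m * q) := by linarith
    have d1 : q ∣ q' := by
      refine Nat.Coprime.dvd_of_dvd_mul_left (k := q) (m := a) hc.symm ?_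
      exact_mod_cast (Dvd.intro _ h1.symm : (q : ℤ) ∣ a * q')
    have d2 : q' ∣ q := by
      refine Nat.Coprime.dvd_of_dvd_mul_left (k := q') (m := a') hc'.symm ?_
      exact_mod_cast (Dvd.intro _ h2.symm : (q' : ℤ) ∣ a' * q)
    obtain rfl := Nat.dvd_antisymm d1 d2
    have hqz : (q : ℤ) ≠ 0 := by exact_mod_cast hq.ne'
    have h3 : (a : ℤ) = a' + m * q := by
      apply mul_left_cancel₀ hqz
      linarith
    have h4 : (a : ℤ) % q = (a' : ℤ) % q := by rw [h3, Int.add_mul_emod_self_right]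
    rw [Int.emod_eq_of_lt (by positivity) (by exact_mod_cast ha),
      Int.emod_eq_of_lt (by positivity) (by exact_mod_cast ha')] at h4
    exact hne (by rw [Int.natCast_inj.1 h4])
  have hk1 : (1 : ℝ) ≤ |(k : ℝ)| := by exact_mod_cast Int.one_le_abs hk0
  have heq : (a : ℝ) / q - (a' : ℝ) / q' - m = k / (q * q') := by
    rw [hk]; push_cast; field_simp
  rw [heq, abs_div, abs_of_pos (mul_pos hqr hqr')]
  have h5 : (q : ℝ) * q' ≤ R ^ 2 := by
    rw [sq]; gcongr
  gcongr

/-- The large sieve inequality for Farey fractions. -/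
theorem large_sieve_farey (a : ℕ → ℂ) {N R : ℕ} (hR : 0 < R) (hN : R ^ 2 ≤ N) :
    ∑ q ∈ Icc 1 R, ∑ b ∈ range q with b.Coprime q,
        ‖∑ n ∈ range N, a n * e (n * ((b : ℝ) / q))‖ ^ 2 ≤
      5 * N * ∑ n ∈ range N, ‖a n‖ ^ 2 := by
  rw [sum_sigma']
  have hRr : (0 : ℝ) < R := by exact_mod_cast hR
  refine large_sieve _ (fun p : (_ : ℕ) × ℕ ↦ (p.2 : ℝ) / p.1) (δ := 1 / (R : ℝ) ^ 2)
    (by positivity) ?_ a ?_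
  · rintro ⟨q, b⟩ h ⟨q', b'⟩ h' hne m
    simp only [mem_sigma, mem_Icc, mem_filter, mem_range] at h h'
    refine farey_spacing h.1.1 h.1.2 h'.1.1 h'.1.2 h.2.1 h'.2.1 h.2.2 h'.2.2 ?_ m
    intro h
    simp only [Prod.mk.injEq] at h
    exact hne (by rw [h.1, h.2])
  · rw [one_div_one_div]; exact_mod_cast hN

theorem norm_gaussSum_sq_of_isPrimitive {q : ℕ} [NeZero q] {χ : DirichletCharacter ℂ q}
    (hχ : χ.IsPrimitive) : ‖gaussSum χ ZMod.stdAddChar‖ ^ 2 = q := by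
  set τ := gaussSum χ ZMod.stdAddChar with hτ
  have h1 : ZMod.dft (ZMod.dft χ) (-1) = q := by
    rw [ZMod.dft_dft]; simp
  have h2 : ZMod.dft χ = fun k ↦ χ⁻¹ (-k) * τ :=
    funext fun k ↦ hχ.fourierTransform_eq_inv_mul_gaussSum k
  have h3 : ZMod.dft (ZMod.dft χ) (-1) = star τ * τ := by
    rw [h2, ZMod.dft_apply]
    nth_rewrite 2 [hτ]
    rw [star_gaussSum_eq, gaussSum, sum_mul]
    refine Fintype.sum_equiv (Equiv.neg _) _ _ fun j ↦ ?_
    simp only [Equiv.neg_apply, smul_eq_mul, AddChar.inv_apply, mul_neg, mul_one, neg_neg]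
    ring
  rw [h1] at h3
  have h4 : ((‖τ‖ ^ 2 : ℝ) : ℂ) = q := by
    rw [h3, Complex.ofReal_pow, ← Complex.conj_mul']; rfl
  exact_mod_cast h4

theorem sum_norm_sum_character_sq {q : ℕ} [NeZero q] (f : ZMod q → ℂ) :
    ∑ χ : DirichletCharacter ℂ q, ‖∑ x, χ x * f x‖ ^ 2 =
      (Nat.totient q : ℝ) * ∑ x with IsUnit x, ‖f x‖ ^ 2 := by
  have key : ((∑ χ : DirichletCharacter ℂ q, ‖∑ x, χ x * f x‖ ^ 2 : ℝ) : ℂ) =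
      (((Nat.totient q : ℝ) * ∑ x with IsUnit x, ‖f x‖ ^ 2 : ℝ) : ℂ) := by
    have hχ : ∀ χ : DirichletCharacter ℂ q, ((‖∑ x, χ x * f x‖ ^ 2 : ℝ) : ℂ) =
        ∑ y with IsUnit y, ∑ x, χ y⁻¹ * χ x * (f x * (starRingEnd ℂ) (f y)) := by
      intro χ
      rw [Complex.ofReal_pow, ← Complex.mul_conj', map_sum, sum_mul_sum, sum_comm, sum_filter]
      refine sum_congr rfl fun y _ ↦ ?_
      split_ifs with hy
      · refine sum_congr rfl fun x _ ↦ ?_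
        have : (starRingEnd ℂ) (χ y) = χ y⁻¹ := by
          rw [starRingEnd_apply, MulChar.star_apply', MulChar.inv_apply]
          congr 1
          exact hy.mul_left_cancel (by
            rw [Ring.mul_inverse_cancel y hy, ZMod.mul_inv_of_unit y hy])
        rw [map_mul, this]; ring
      · simp [χ.map_nonunit hy]
    rw [Complex.ofReal_sum, sum_congr rfl fun χ _ ↦ hχ χ, sum_comm]
    rw [Complex.ofReal_mul, Complex.ofReal_sum, mul_sum]
    refine sum_congr rfl fun y hy ↦ ?_
    rw [sum_comm]
    simp only [← sum_mul]
    simp only [DirichletCharacter.sum_char_inv_mul_char_eq ℂ (mem_filter.1 hy).2, ite_mul, zero_mul,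
      sum_ite_eq, mem_univ, if_true, Complex.mul_conj']
    push_cast; rfl
  exact_mod_cast key

theorem stdAddChar_natCast_mul {q : ℕ} [NeZero q] (n b : ℕ) :
    ZMod.stdAddChar ((n : ZMod q) * (b : ZMod q)) = e (n * ((b : ℝ) / q)) := by
  have : (n : ZMod q) * (b : ZMod q) = ((n * b : ℤ) : ZMod q) := by push_cast; rfl
  rw [this, ZMod.stdAddChar_coe, e]
  congr 1
  push_cast; ring

theorem sum_isUnit_zmod {q : ℕ} [NeZero q] (f : ZMod q → ℝ) :
    ∑ x with IsUnit x, f x = ∑ b ∈ range q with b.Coprime q, f b := by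
  refine sum_nbij' ZMod.val (fun b ↦ (b : ZMod q)) ?_ ?_ ?_ ?_ ?_
  · intro x hx
    rw [mem_filter, mem_range]
    refine ⟨x.val_lt, ?_⟩
    rw [← ZMod.isUnit_iff_coprime, ZMod.natCast_zmod_val]
    exact (mem_filter.1 hx).2
  · intro b hb
    rw [mem_filter, ZMod.isUnit_iff_coprime]
    exact ⟨mem_univ _, (mem_filter.1 hb).2⟩
  · intro x _
    exact ZMod.natCast_zmod_val x
  · intro b hb
    exact ZMod.val_cast_of_lt (mem_range.1 (mem_filter.1 hb).1)
  · intro x _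
    rw [ZMod.natCast_zmod_val]

/-- Primitive character sums are controlled by additive exponential sums. -/
theorem sum_primitive_norm_sq_le {q : ℕ} (hq : 0 < q) (a : ℕ → ℂ) (s : Finset ℕ) :
    ∑ χ : DirichletCharacter ℂ q,
        (if χ.IsPrimitive then ‖∑ n ∈ s, a n * χ (n : ZMod q)‖ ^ 2 else 0) ≤
      (Nat.totient q : ℝ) / q * ∑ b ∈ range q with b.Coprime q,
        ‖∑ n ∈ s, a n * e (n * ((b : ℝ) / q))‖ ^ 2 := by
  have : NeZero q := ⟨hq.ne'⟩
  have hqr : (0 : ℝ) < q := by exact_mod_cast hq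
  set f : ZMod q → ℂ := fun x ↦ ∑ n ∈ s, a n * ZMod.stdAddChar ((n : ZMod q) * x) with hf
  have hpt : ∀ χ : DirichletCharacter ℂ q,
      (if χ.IsPrimitive then ‖∑ n ∈ s, a n * χ (n : ZMod q)‖ ^ 2 else 0) ≤
        1 / q * ‖∑ x, χ⁻¹ x * f x‖ ^ 2 := by
    intro χ
    split_ifs with hχ
    · have hχ' : χ⁻¹.IsPrimitive := by
        rw [DirichletCharacter.isPrimitive_def, DirichletCharacter.conductor_inv]
        exact hχ
      have hmul : (∑ n ∈ s, a n * χ (n : ZMod q)) * gaussSum χ⁻¹ ZMod.stdAddChar =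
          ∑ x, χ⁻¹ x * f x := by
        simp only [hf, mul_sum]
        rw [sum_comm, sum_mul]
        refine sum_congr rfl fun n _ ↦ ?_
        have := gaussSum_mulShift_of_isPrimitive ZMod.stdAddChar hχ' (n : ZMod q)
        rw [inv_inv] at this
        rw [mul_assoc, ← this, gaussSum, mul_sum]
        refine sum_congr rfl fun x _ ↦ ?_
        rw [AddChar.mulShift_apply]; ring
      rw [← hmul, norm_mul, mul_pow, norm_gaussSum_sq_of_isPrimitive hχ']
      refine le_of_eq ?_
      field_simp
    · positivity
  refine (sum_le_sum fun χ _ ↦ hpt χ).trans_eq ?_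
  rw [← mul_sum, Fintype.sum_equiv (Equiv.inv (DirichletCharacter ℂ q))
    (fun χ ↦ ‖∑ x, χ⁻¹ x * f x‖ ^ 2) (fun χ ↦ ‖∑ x, χ x * f x‖ ^ 2) fun χ ↦ rfl,
    sum_norm_sum_character_sq, sum_isUnit_zmod]
  simp only [hf, stdAddChar_natCast_mul]
  ring

/-- The large sieve inequality for Farey fractions, for coefficients supported on a finite set. -/
theorem large_sieve_farey_finset (a : ℕ → ℂ) {s : Finset ℕ} {N R : ℕ} (hR : 0 < R)
    (hs : s ⊆ range N) (hN : R ^ 2 ≤ N) :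
    ∑ q ∈ Icc 1 R, ∑ b ∈ range q with b.Coprime q,
        ‖∑ n ∈ s, a n * e (n * ((b : ℝ) / q))‖ ^ 2 ≤ 5 * N * ∑ n ∈ s, ‖a n‖ ^ 2 := by
  have h := large_sieve_farey (fun n ↦ if n ∈ s then a n else 0) hR hN
  simpa only [ite_mul, zero_mul, apply_ite (fun z : ℂ ↦ ‖z‖ ^ 2), norm_zero,
    zero_pow two_ne_zero, sum_ite_mem, inter_eq_right.2 hs] using h

theorem sum_range_succ_mul_two_pow_le (m : ℕ) :
    ∑ k ∈ range m, ((k : ℝ) + 1) * 2 ^ (k + 1) ≤ m * 2 ^ (m + 1) := by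
  induction m with
  | zero => simp
  | succ m ih =>
    rw [sum_range_succ, pow_succ 2 (m + 1)]
    push_cast
    nlinarith [pow_pos (two_pos : (0 : ℝ) < 2) (m + 1)]

theorem sum_range_succ_div_two_pow_le (m : ℕ) :
    ∑ k ∈ range m, ((k : ℝ) + 1) / 2 ^ k ≤ 4 := by
  have h : ∑ k ∈ range m, ((k : ℝ) + 1) / 2 ^ k = 4 - (2 * m + 4) / 2 ^ m := by
    induction m with
    | zero => norm_num
    | succ m ih =>
      rw [sum_range_succ, ih, pow_succ]
      push_cast
      field_simp
      ring
  rw [h]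
  have : (0 : ℝ) ≤ (2 * m + 4) / 2 ^ m := by positivity
  linarith

theorem two_pow_natLog_floor_le {x : ℝ} (hx : 1 ≤ x) : (2 : ℝ) ^ Nat.log 2 ⌊x⌋₊ ≤ x := by
  have h1 : 2 ^ Nat.log 2 ⌊x⌋₊ ≤ ⌊x⌋₊ :=
    Nat.pow_log_le_self 2 (Nat.floor_pos.2 hx).ne'
  calc (2 : ℝ) ^ Nat.log 2 ⌊x⌋₊ ≤ (⌊x⌋₊ : ℝ) := by exact_mod_cast h1
    _ ≤ x := Nat.floor_le (by linarith)

theorem lt_two_pow_natLog_floor_succ (x : ℝ) : x < 2 ^ (Nat.log 2 ⌊x⌋₊ + 1) := by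
  have h1 : ⌊x⌋₊ + 1 ≤ 2 ^ (Nat.log 2 ⌊x⌋₊ + 1) := Nat.lt_pow_succ_log_self one_lt_two _
  calc x < (⌊x⌋₊ : ℝ) + 1 := Nat.lt_floor_add_one x
    _ ≤ _ := by exact_mod_cast h1

/-- Dyadic summation of a large sieve type bound against the weight `log (Q / q) / q`. -/
theorem sum_log_div_mul_le (F : ℕ → ℝ) (hF : ∀ q, 0 ≤ F q) {P G Q Q₀ : ℝ} (hP : 0 ≤ P)
    (hG : 0 ≤ G) (hQ₀ : 1 ≤ Q₀) (hQ : Q₀ ≤ Q)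
    (hsieve : ∀ R : ℕ, 0 < R → ∑ q ∈ Icc 1 R, F q ≤ 5 * (P + (R : ℝ) ^ 2) * G) :
    ∑ q ∈ Ioc ⌊Q₀⌋₊ ⌊Q⌋₊, Real.log (Q / q) / q * F q ≤
      20 * G * (P * (1 + 2 * Real.log Q) / Q₀ + 2 * Q) := by
  have hQ₀pos : 0 < Q₀ := by linarith
  have hQpos : 0 < Q := by linarith
  have hQQ₀ : 1 ≤ Q / Q₀ := by rwa [one_le_div hQ₀pos]
  set K := Nat.log 2 ⌊Q / Q₀⌋₊ with hK
  have h2K : (2 : ℝ) ^ K ≤ Q / Q₀ := two_pow_natLog_floor_le hQQ₀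
  have hKlog : (K : ℝ) ≤ 2 * Real.log Q := by
    have h1 : (K : ℝ) * Real.log 2 ≤ Real.log Q := by
      rw [← Real.log_pow]
      exact Real.log_le_log (by positivity) (h2K.trans (div_le_self hQpos.le hQ₀))
    have h2 : (1 : ℝ) / 2 ≤ Real.log 2 := by linarith [Real.log_two_gt_d9]
    nlinarith [Nat.cast_nonneg (α := ℝ) K]
  set w : ℕ → ℝ := fun k ↦ ((k : ℝ) + 1) * 2 ^ (k + 1) / Q with hw
  have hw0 : ∀ k, 0 ≤ w k := fun k ↦ by positivity
  have hpt : ∀ q ∈ Ioc ⌊Q₀⌋₊ ⌊Q⌋₊, Real.log (Q / q) / q * F q ≤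
      ∑ k ∈ range (K + 1), w k * (if q ≤ ⌊Q / 2 ^ k⌋₊ then F q else 0) := by
    intro q hq
    rw [mem_Ioc] at hq
    have hqQ₀ : Q₀ < q := (Nat.floor_lt hQ₀pos.le).1 hq.1
    have hqQ : (q : ℝ) ≤ Q := (Nat.le_floor_iff hQpos.le).1 hq.2
    have hq0 : (0 : ℝ) < q := by linarith
    set k := Nat.log 2 ⌊Q / q⌋₊ with hk
    have hk1 : (2 : ℝ) ^ k ≤ Q / q := two_pow_natLog_floor_le (by rwa [one_le_div hq0])
    have hk2 : Q / q < 2 ^ (k + 1) := lt_two_pow_natLog_floor_succ _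
    have hkK : k ≤ K := by
      refine Nat.log_mono_right (Nat.floor_mono ?_)
      gcongr
    have hqk : q ≤ ⌊Q / 2 ^ k⌋₊ := by
      refine Nat.le_floor ?_
      rw [le_div_iff₀ (by positivity), mul_comm]
      rwa [le_div_iff₀ hq0] at hk1
    have hlog : Real.log (Q / q) ≤ k + 1 := by
      calc Real.log (Q / q) ≤ Real.log (2 ^ (k + 1)) :=
            Real.log_le_log (by positivity) hk2.le
        _ = (k + 1) * Real.log 2 := by rw [Real.log_pow]; push_cast; rfl
        _ ≤ (k + 1) * 1 := by
            gcongr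
            linarith [Real.log_two_lt_d9]
        _ = _ := mul_one _
    have hinv : 1 / (q : ℝ) ≤ 2 ^ (k + 1) / Q := by
      rw [div_le_div_iff₀ hq0 hQpos, one_mul]
      rw [div_lt_iff₀ hq0] at hk2
      exact hk2.le
    calc Real.log (Q / q) / q * F q = Real.log (Q / q) * (1 / q) * F q := by ring
      _ ≤ (k + 1) * (2 ^ (k + 1) / Q) * F q := by
          have := hF q
          gcongr
      _ = w k * (if q ≤ ⌊Q / 2 ^ k⌋₊ then F q else 0) := by
          rw [if_pos hqk, hw]; ring
      _ ≤ _ := single_le_sum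
          (f := fun k ↦ w k * (if q ≤ ⌊Q / 2 ^ k⌋₊ then F q else 0))
          (fun k _ ↦ mul_nonneg (hw0 k) (by split_ifs; exacts [hF q, le_rfl]))
          (mem_range.2 (Nat.lt_succ_of_le hkK))
  have hblock : ∀ k ∈ range (K + 1),
      ∑ q ∈ Ioc ⌊Q₀⌋₊ ⌊Q⌋₊, (if q ≤ ⌊Q / 2 ^ k⌋₊ then F q else 0) ≤
        5 * (P + (Q / 2 ^ k) ^ 2) * G := by
    intro k hk
    have hkQ : 1 ≤ Q / 2 ^ k := by
      rw [one_le_div (by positivity)]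
      calc (2 : ℝ) ^ k ≤ 2 ^ K :=
            pow_le_pow_right₀ one_le_two (Nat.le_of_lt_succ (mem_range.1 hk))
        _ ≤ Q / Q₀ := h2K
        _ ≤ Q := div_le_self hQpos.le hQ₀
    calc _ = ∑ q ∈ Ioc ⌊Q₀⌋₊ ⌊Q⌋₊ with q ≤ ⌊Q / 2 ^ k⌋₊, F q := (sum_filter _ _).symm
      _ ≤ ∑ q ∈ Icc 1 ⌊Q / 2 ^ k⌋₊, F q := by
          refine sum_le_sum_of_subset_of_nonneg (fun q hq ↦ ?_) fun q _ _ ↦ hF q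
          rw [mem_filter, mem_Ioc] at hq
          rw [mem_Icc]
          omega
      _ ≤ _ := hsieve _ (Nat.floor_pos.2 hkQ)
      _ ≤ _ := by
          gcongr
          exact Nat.floor_le (by linarith)
  calc ∑ q ∈ Ioc ⌊Q₀⌋₊ ⌊Q⌋₊, Real.log (Q / q) / q * F q
      ≤ ∑ q ∈ Ioc ⌊Q₀⌋₊ ⌊Q⌋₊, ∑ k ∈ range (K + 1),
          w k * (if q ≤ ⌊Q / 2 ^ k⌋₊ then F q else 0) := sum_le_sum hpt
    _ = ∑ k ∈ range (K + 1), w k *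
          ∑ q ∈ Ioc ⌊Q₀⌋₊ ⌊Q⌋₊, (if q ≤ ⌊Q / 2 ^ k⌋₊ then F q else 0) := by
        rw [sum_comm]
        simp only [mul_sum]
    _ ≤ ∑ k ∈ range (K + 1), w k * (5 * (P + (Q / 2 ^ k) ^ 2) * G) :=
        sum_le_sum fun k hk ↦ mul_le_mul_of_nonneg_left (hblock k hk) (hw0 k)
    _ = 5 * G * (P / Q * ∑ k ∈ range (K + 1), ((k : ℝ) + 1) * 2 ^ (k + 1) +
          2 * Q * ∑ k ∈ range (K + 1), ((k : ℝ) + 1) / 2 ^ k) := by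
        rw [mul_sum, mul_sum, ← sum_add_distrib, mul_sum]
        refine sum_congr rfl fun k _ ↦ ?_
        rw [hw]
        field_simp
        ring
    _ ≤ 5 * G * (P / Q * ((K + 1 : ℕ) * 2 ^ (K + 1 + 1)) + 2 * Q * 4) := by
        gcongr
        · exact sum_range_succ_mul_two_pow_le _
        · exact sum_range_succ_div_two_pow_le _
    _ = 5 * G * (P / Q * ((1 + K) * 4 * 2 ^ K) + 2 * Q * 4) := by
        push_cast; ring
    _ ≤ 5 * G * (P / Q * ((1 + 2 * Real.log Q) * 4 * (Q / Q₀)) + 2 * Q * 4) := by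
        have : 0 ≤ Real.log Q := Real.log_nonneg (hQ₀.trans hQ)
        gcongr
    _ = _ := by
        field_simp
        ring

theorem sum_vonMangoldt_sq_le {X : ℝ} (hX : 1 ≤ X) (M : ℕ) :
    ∑ n ∈ Ioc M ⌊X⌋₊, ArithmeticFunction.vonMangoldt n ^ 2 ≤
      (Real.log 4 + 4) * (X * Real.log X) := by
  calc ∑ n ∈ Ioc M ⌊X⌋₊, ArithmeticFunction.vonMangoldt n ^ 2
      ≤ ∑ n ∈ Ioc M ⌊X⌋₊, Real.log X * ArithmeticFunction.vonMangoldt n := by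
        refine sum_le_sum fun n hn ↦ ?_
        rw [mem_Ioc] at hn
        rw [sq]
        refine mul_le_mul_of_nonneg_right ?_ ArithmeticFunction.vonMangoldt_nonneg
        refine ArithmeticFunction.vonMangoldt_le_log.trans (Real.log_le_log ?_ ?_)
        · exact_mod_cast (Nat.zero_le M).trans_lt hn.1
        · exact (Nat.le_floor_iff (by linarith)).1 hn.2
    _ = Real.log X * ∑ n ∈ Ioc M ⌊X⌋₊, ArithmeticFunction.vonMangoldt n := by rw [mul_sum]
    _ ≤ Real.log X * Chebyshev.psi X := by
        refine mul_le_mul_of_nonneg_left ?_ (Real.log_nonneg hX)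
        exact sum_le_sum_of_subset_of_nonneg (Ioc_subset_Ioc_left (Nat.zero_le M))
          fun _ _ _ ↦ ArithmeticFunction.vonMangoldt_nonneg
    _ ≤ Real.log X * ((Real.log 4 + 4) * X) := by
        refine mul_le_mul_of_nonneg_left ?_ (Real.log_nonneg hX)
        exact Chebyshev.psi_le_const_mul_self (by linarith)
    _ = _ := by ring

/-- Large-sieve bound for the weighted average over primitive characters with large
conductor of squares of exponential sums over primes. -/
theorem large_conductor_exponential_sum_bound (μ c A : ℝ)
    (hμ0 : 0 < μ) (hμ1 : μ < 1) (hc : 1 < c) (hA : 0 < A) :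
    ∃ K > 0, ∃ X₀ : ℝ, ∀ X : ℝ, X₀ ≤ X →
      ∀ t : ℝ, ∀ Q : ℝ, X / Real.log X ^ A ≤ Q → Q ≤ X →
        ∑ q ∈ Ioc ⌊Real.log X ^ (A + 2)⌋₊ ⌊Q⌋₊,
            (1 / (Nat.totient q : ℝ)) * Real.log (Q / q) *
              ∑ χ : DirichletCharacter ℂ q,
                (if χ.IsPrimitive then
                  ‖∑ n ∈ Ioc ⌊μ * X⌋₊ ⌊X⌋₊,
                      (ArithmeticFunction.vonMangoldt n : ℂ) * χ (n : ZMod q)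
                        * e (t * (n : ℝ) ^ c)‖ ^ 2
                else 0)
          ≤ K * (X * Q * Real.log X) := by
  have hC₀ : 0 < Real.log 4 + 4 := by
    have := Real.log_pos (show (1 : ℝ) < 4 by norm_num)
    linarith
  refine ⟨160 * (Real.log 4 + 4), by positivity, Real.exp 1, fun X hX t Q hQlow hQX ↦ ?_⟩
  have hX1 : 1 ≤ X := (Real.one_le_exp zero_le_one).trans hX
  have hXpos : 0 < X := by linarith
  set L := Real.log X with hL
  have hL1 : 1 ≤ L := by rwa [hL, Real.le_log_iff_exp_le hXpos]
  have hLpos : 0 < L := by linarith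
  have hLA : 0 < L ^ A := Real.rpow_pos_of_pos hLpos A
  have hQpos : 0 < Q := (by positivity : 0 < X / L ^ A).trans_le hQlow
  have hQ₀1 : 1 ≤ L ^ (A + 2) := Real.one_le_rpow hL1 (by linarith)
  rcases lt_or_ge Q (L ^ (A + 2)) with hlt | hge
  · rw [Ioc_eq_empty (not_lt.2 (Nat.floor_mono hlt.le)), sum_empty]
    positivity
  set s := Ioc ⌊μ * X⌋₊ ⌊X⌋₊ with hs
  set a : ℕ → ℂ := fun n ↦ (ArithmeticFunction.vonMangoldt n : ℂ) * e (t * (n : ℝ) ^ c) with ha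
  set F : ℕ → ℝ := fun q ↦ ∑ b ∈ range q with b.Coprime q,
    ‖∑ n ∈ s, a n * e (n * ((b : ℝ) / q))‖ ^ 2 with hF
  set G := ∑ n ∈ s, ‖a n‖ ^ 2 with hG
  have hG0 : 0 ≤ G := by positivity
  have hGle : G ≤ (Real.log 4 + 4) * (X * L) := by
    refine le_of_eq_of_le (sum_congr rfl fun n _ ↦ ?_) (sum_vonMangoldt_sq_le hX1 ⌊μ * X⌋₊)
    rw [ha, norm_mul, norm_e, mul_one, Complex.norm_real, Real.norm_eq_abs, sq_abs]
  have hsieve : ∀ R : ℕ, 0 < R → ∑ q ∈ Icc 1 R, F q ≤ 5 * (2 * X + (R : ℝ) ^ 2) * G := by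
    intro R hR
    have hsub : s ⊆ range (⌊X⌋₊ + 1 + R ^ 2) := fun n hn ↦ by
      rw [hs, mem_Ioc] at hn
      rw [mem_range]
      omega
    refine (large_sieve_farey_finset a hR hsub (by omega)).trans ?_
    have := Nat.floor_le hXpos.le
    gcongr
    push_cast
    linarith
  have hterm : ∀ q ∈ Ioc ⌊L ^ (A + 2)⌋₊ ⌊Q⌋₊,
      (1 / (Nat.totient q : ℝ)) * Real.log (Q / q) *
        ∑ χ : DirichletCharacter ℂ q,
          (if χ.IsPrimitive then
            ‖∑ n ∈ s, (ArithmeticFunction.vonMangoldt n : ℂ) * χ (n : ZMod q)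
              * e (t * (n : ℝ) ^ c)‖ ^ 2 else 0) ≤ Real.log (Q / q) / q * F q := by
    intro q hq
    rw [mem_Ioc] at hq
    have hq0 : 0 < q := (Nat.zero_le _).trans_lt hq.1
    have hqr : (0 : ℝ) < q := by exact_mod_cast hq0
    have hφ : (0 : ℝ) < Nat.totient q := by exact_mod_cast Nat.totient_pos.2 hq0
    have hqQ : (q : ℝ) ≤ Q := (Nat.le_floor_iff hQpos.le).1 hq.2
    have hlog : 0 ≤ Real.log (Q / q) := Real.log_nonneg (by rwa [one_le_div hqr])
    have h := sum_primitive_norm_sq_le hq0 a s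
    have hcomm : ∀ χ : DirichletCharacter ℂ q,
        ∑ n ∈ s, (ArithmeticFunction.vonMangoldt n : ℂ) * χ (n : ZMod q) * e (t * (n : ℝ) ^ c) =
          ∑ n ∈ s, a n * χ (n : ZMod q) := fun χ ↦
      sum_congr rfl fun n _ ↦ by rw [ha]; ring
    simp only [hcomm]
    calc _ ≤ (1 / (Nat.totient q : ℝ)) * Real.log (Q / q) * ((Nat.totient q : ℝ) / q * F q) := by
          gcongr
      _ = _ := by field_simp
  refine (sum_le_sum hterm).trans ((sum_log_div_mul_le F (fun q ↦ by positivity)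
    (by positivity) hG0 hQ₀1 hge hsieve).trans ?_)
  have hlogQ : 1 + 2 * Real.log Q ≤ 3 * L := by
    have := Real.log_le_log hQpos hQX
    linarith
  have hmain : 2 * X * (1 + 2 * Real.log Q) / L ^ (A + 2) ≤ 6 * Q := by
    rw [div_le_iff₀ (by positivity)]
    have h1 : L ^ (A + 2) = L ^ A * L ^ 2 := by
      rw [Real.rpow_add hLpos]
      norm_num
    have h2 : X ≤ Q * L ^ A := (div_le_iff₀ hLA).1 hQlow
    calc 2 * X * (1 + 2 * Real.log Q) ≤ 2 * X * (3 * L) := by gcongr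
      _ ≤ 2 * (Q * L ^ A) * (3 * L ^ 2) := by
          gcongr
          nlinarith
      _ = _ := by rw [h1]; ring
  calc _ ≤ 20 * ((Real.log 4 + 4) * (X * L)) * (6 * Q + 2 * Q) := by
        have : 0 ≤ Real.log Q := Real.log_nonneg (hQ₀1.trans hge)
        gcongr
    _ = _ := by ring
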